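/- arXiv:2403.04129 — 3 statements merged into one kernel-verified Lean document; each statement's English description precedes it below -/
import Mathlib

section
/- For every integer n ≥ 2, a set J of edges of G_n is a perfect matching of G_n if and only if there exists i ∈ {1, …, n} such that J = {x a_i, y b_i} ∪ { a_j b_j : 1 ≤ j ≤ n, j ≠ i }. -/
open Finset

/-- Vertices of the graph `G n`: `Sum.inl i` is `aᵢ`, `Sum.inr (Sum.inl i)` is `bᵢ`,
`Sum.inr (Sum.inr false)` is `x`, and `Sum.inr (Sum.inr true)` is `y`. -/
abbrev Vn (n : ℕ) := Fin n ⊕ Fin n ⊕ Bool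

def va {n : ℕ} (i : Fin n) : Vn n := Sum.inl i
def vb {n : ℕ} (i : Fin n) : Vn n := Sum.inr (Sum.inl i)
def vx {n : ℕ} : Vn n := Sum.inr (Sum.inr false)
def vy {n : ℕ} : Vn n := Sum.inr (Sum.inr true)

/-- The edge set of the graph `Gₙ`: edges `aᵢbᵢ`, `x aᵢ` and `y bᵢ` for `1 ≤ i ≤ n`. -/
def Gedges (n : ℕ) : Finset (Sym2 (Vn n)) :=
  (Finset.univ.image fun i : Fin n => s(va i, vb i)) ∪
  (Finset.univ.image fun i : Fin n => s(vx, va i)) ∪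
  (Finset.univ.image fun i : Fin n => s(vy, vb i))

lemma mem_Gedges {n : ℕ} {e : Sym2 (Vn n)} :
    e ∈ Gedges n ↔
      ∃ i : Fin n, e = s(va i, vb i) ∨ e = s(vx, va i) ∨ e = s(vy, vb i) := by
  simp only [Gedges, mem_union, mem_image, mem_univ, true_and, exists_or, eq_comm (a := e),
    or_assoc]

lemma eq_of_va_mem {n : ℕ} {e : Sym2 (Vn n)} (he : e ∈ Gedges n) {i : Fin n} (h : va i ∈ e) :
    e = s(va i, vb i) ∨ e = s(vx, va i) := by
  obtain ⟨j, rfl | rfl | rfl⟩ := mem_Gedges.1 he <;> simp_all [va, vb, vx, vy]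

lemma eq_of_vb_mem {n : ℕ} {e : Sym2 (Vn n)} (he : e ∈ Gedges n) {i : Fin n} (h : vb i ∈ e) :
    e = s(va i, vb i) ∨ e = s(vy, vb i) := by
  obtain ⟨j, rfl | rfl | rfl⟩ := mem_Gedges.1 he <;> simp_all [va, vb, vx, vy]

lemma exists_eq_of_vx_mem {n : ℕ} {e : Sym2 (Vn n)} (he : e ∈ Gedges n) (h : vx ∈ e) :
    ∃ i, e = s(vx, va i) := by
  obtain ⟨j, rfl | rfl | rfl⟩ := mem_Gedges.1 he <;> simp_all [va, vb, vx, vy]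

lemma exists_eq_of_vy_mem {n : ℕ} {e : Sym2 (Vn n)} (he : e ∈ Gedges n) (h : vy ∈ e) :
    ∃ i, e = s(vy, vb i) := by
  obtain ⟨j, rfl | rfl | rfl⟩ := mem_Gedges.1 he <;> simp_all [va, vb, vx, vy]

/-- A set `J` of edges of `Gₙ` is a perfect matching (every vertex lies in exactly one
edge of `J`) if and only if `J = {x aᵢ, y bᵢ} ∪ {aⱼbⱼ : j ≠ i}` for some `i`. -/
theorem perfectMatchings_of_Gn (n : ℕ) (hn : 2 ≤ n) (J : Finset (Sym2 (Vn n))) :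
    (J ⊆ Gedges n ∧ ∀ v : Vn n, ∃! e, e ∈ J ∧ v ∈ e) ↔
      ∃ i : Fin n, J = {s(vx, va i), s(vy, vb i)} ∪
        (Finset.univ.filter (fun j : Fin n => j ≠ i)).image (fun j => s(va j, vb j)) := by
  constructor
  · rintro ⟨hJ, hv⟩
    obtain ⟨e, ⟨heJ, hxe⟩, -⟩ := hv vx
    obtain ⟨i, rfl⟩ := exists_eq_of_vx_mem (hJ heJ) hxe
    obtain ⟨f, ⟨hfJ, hyf⟩, -⟩ := hv vy
    obtain ⟨k, rfl⟩ := exists_eq_of_vy_mem (hJ hfJ) hyf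
    have hx : ∀ j, s(vx, va j) ∈ J → j = i := fun j hj => by
      simpa [va, vx] using (hv vx).unique ⟨hj, by simp⟩ ⟨heJ, by simp⟩
    have hy : ∀ j, s(vy, vb j) ∈ J → j = k := fun j hj => by
      simpa [vb, vy] using (hv vy).unique ⟨hj, by simp⟩ ⟨hfJ, by simp⟩
    have hi : s(va i, vb i) ∉ J := fun h => by
      simpa [va, vb, vx] using (hv (va i)).unique ⟨h, by simp⟩ ⟨heJ, by simp⟩
    have hab : ∀ j, j ≠ i → s(va j, vb j) ∈ J := fun j hj => by
      obtain ⟨e, ⟨he, hje⟩, -⟩ := hv (va j)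
      obtain rfl | rfl := eq_of_va_mem (hJ he) hje
      · exact he
      · exact absurd (hx j he) hj
    obtain rfl : i = k := by
      obtain ⟨e, ⟨he, hie⟩, -⟩ := hv (vb i)
      obtain rfl | rfl := eq_of_vb_mem (hJ he) hie
      · exact absurd he hi
      · exact hy i he
    refine ⟨i, Finset.Subset.antisymm (fun e he => ?_) (fun e he => ?_)⟩
    · simp only [mem_union, mem_insert, mem_singleton, mem_image, mem_filter, mem_univ, true_and]
      obtain ⟨j, rfl | rfl | rfl⟩ := mem_Gedges.1 (hJ he)
      · exact .inr ⟨j, fun h => hi (h ▸ he), rfl⟩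
      · exact .inl (.inl (by rw [hx j he]))
      · exact .inl (.inr (by rw [hy j he]))
    · simp only [mem_union, mem_insert, mem_singleton, mem_image, mem_filter, mem_univ,
        true_and] at he
      obtain (rfl | rfl) | ⟨j, hj, rfl⟩ := he
      exacts [heJ, hfJ, hab j hj]
  · rintro ⟨i, rfl⟩
    simp only [subset_iff, mem_union, mem_insert, mem_singleton, mem_image, mem_filter, mem_univ,
      true_and]
    refine ⟨?_, ?_⟩
    · rintro e ((rfl | rfl) | ⟨j, -, rfl⟩)
      exacts [mem_Gedges.2 ⟨i, by simp⟩, mem_Gedges.2 ⟨i, by simp⟩, mem_Gedges.2 ⟨j, by simp⟩]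
    · rintro (j | j | _ | _)
      · by_cases hj : j = i
        · refine ⟨s(vx, va i), ⟨by simp, by simp [hj, va]⟩, ?_⟩
          rintro e ⟨(rfl | rfl) | ⟨k, hk, rfl⟩, he⟩ <;> simp_all [va, vb, vx, vy]
        · refine ⟨s(va j, vb j), ⟨.inr ⟨j, hj, rfl⟩, by simp [va]⟩, ?_⟩
          rintro e ⟨(rfl | rfl) | ⟨k, hk, rfl⟩, he⟩ <;> simp_all [va, vb, vx, vy]
      · by_cases hj : j = i
        · refine ⟨s(vy, vb i), ⟨by simp, by simp [hj, vb]⟩, ?_⟩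
          rintro e ⟨(rfl | rfl) | ⟨k, hk, rfl⟩, he⟩ <;> simp_all [va, vb, vx, vy]
        · refine ⟨s(va j, vb j), ⟨.inr ⟨j, hj, rfl⟩, by simp [vb]⟩, ?_⟩
          rintro e ⟨(rfl | rfl) | ⟨k, hk, rfl⟩, he⟩ <;> simp_all [va, vb, vx, vy]
      · refine ⟨s(vx, va i), ⟨by simp, by simp [vx]⟩, ?_⟩
        rintro e ⟨(rfl | rfl) | ⟨k, hk, rfl⟩, he⟩ <;> simp_all [va, vb, vx, vy]
      · refine ⟨s(vy, vb i), ⟨by simp, by simp [vy]⟩, ?_⟩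
        rintro e ⟨(rfl | rfl) | ⟨k, hk, rfl⟩, he⟩ <;> simp_all [va, vb, vx, vy]
end

section
/- For every integer n ≥ 2 and every k ∈ ℕ, the number of magic k-labelings of G_n equals the number of tuples (u_1, …, u_n) ∈ ℕ^n satisfying (u_1 + ⋯ + u_n) − min{u_1, …, u_n} ≤ k. -/
open Finset

/-- Sum of the labels of the edges incident to `v`. -/
def vsum {V : Type} [DecidableEq V] (E : Finset (Sym2 V)) (L : E → ℕ) (v : V) : ℕ :=
  ∑ e ∈ E.attach, if v ∈ e.1 then L e else 0

/-- A labeling is magic if the label sum is the same at every vertex. -/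
def IsMagic {V : Type} [DecidableEq V] (E : Finset (Sym2 V)) (L : E → ℕ) : Prop :=
  ∀ v w : V, vsum E L v = vsum E L w

/-- `magicCount E k` is the number of magic `k`-labelings, i.e. magic labelings
with all labels at most `k`. -/
noncomputable def magicCount {V : Type} [DecidableEq V] (E : Finset (Sym2 V)) (k : ℕ) : ℕ :=
  Set.ncard {L : E → ℕ | IsMagic E L ∧ ∀ e, L e ≤ k}

/-- The edges of `Gₙ`, indexed by the edges `aᵢbᵢ`, then `x aᵢ`, then `y bᵢ`. -/
def edgeSym2 {n : ℕ} : Fin n ⊕ Fin n ⊕ Fin n → Sym2 (Vn n)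
  | Sum.inl i => s(va i, vb i)
  | Sum.inr (Sum.inl i) => s(vx, va i)
  | Sum.inr (Sum.inr i) => s(vy, vb i)

lemma mem_Gedges_iff {n : ℕ} (e : Sym2 (Vn n)) : e ∈ Gedges n ↔ ∃ t, edgeSym2 t = e := by
  simp [Gedges, edgeSym2]

lemma edgeSym2_injective {n : ℕ} : Function.Injective (edgeSym2 (n := n)) := by
  rintro (i | i | i) (j | j | j) h <;> simp_all [edgeSym2, va, vb, vx, vy]

/-- The indexing of the edges of `Gₙ` by `edgeSym2`, as an equivalence. -/
noncomputable def edgeEquiv (n : ℕ) : Fin n ⊕ Fin n ⊕ Fin n ≃ Gedges n :=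
  Equiv.ofBijective (fun t => ⟨edgeSym2 t, (mem_Gedges_iff _).2 ⟨t, rfl⟩⟩)
    ⟨fun _ _ h => edgeSym2_injective (congrArg Subtype.val h),
      fun ⟨e, he⟩ => ((mem_Gedges_iff e).1 he).imp fun _ ht => Subtype.ext ht⟩

lemma vsum_Gedges {n : ℕ} (L : Gedges n → ℕ) (v : Vn n) :
    vsum (Gedges n) L v =
      ∑ t, if v ∈ edgeSym2 t then L (edgeEquiv n t) else 0 := by
  rw [vsum, ← Finset.univ_eq_attach, ← (edgeEquiv n).sum_comp]
  rfl

lemma isMagic_Gedges_iff {n : ℕ} (L : Gedges n → ℕ) :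
    IsMagic (Gedges n) L ↔ ∀ i,
      L (edgeEquiv n (.inr (.inr i))) = L (edgeEquiv n (.inr (.inl i))) ∧
      L (edgeEquiv n (.inl i)) + L (edgeEquiv n (.inr (.inl i))) =
        ∑ j, L (edgeEquiv n (.inr (.inl j))) := by
  have ha (i : Fin n) : vsum (Gedges n) L (va i) =
      L (edgeEquiv n (.inl i)) + L (edgeEquiv n (.inr (.inl i))) := by
    simp [vsum_Gedges, edgeSym2, va, vb, vx, vy]
  have hb (i : Fin n) : vsum (Gedges n) L (vb i) =
      L (edgeEquiv n (.inl i)) + L (edgeEquiv n (.inr (.inr i))) := by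
    simp [vsum_Gedges, edgeSym2, va, vb, vx, vy]
  have hx : vsum (Gedges n) L vx = ∑ j, L (edgeEquiv n (.inr (.inl j))) := by
    simp [vsum_Gedges, edgeSym2, va, vb, vx, vy]
  have hy : vsum (Gedges n) L vy = ∑ j, L (edgeEquiv n (.inr (.inr j))) := by
    simp [vsum_Gedges, edgeSym2, va, vb, vx, vy]
  constructor
  · intro h i
    have h₁ := h (va i) (vb i)
    have h₂ := h (va i) vx
    rw [ha, hb] at h₁
    rw [ha, hx] at h₂
    exact ⟨by omega, h₂⟩
  · intro h
    have key (v : Vn n) : vsum (Gedges n) L v = ∑ j, L (edgeEquiv n (.inr (.inl j))) := by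
      rcases v with i | i | _ | _
      · exact (ha i).trans (h i).2
      · exact (hb i).trans (by rw [(h i).1, (h i).2])
      · exact hx
      · exact hy.trans (Finset.sum_congr rfl fun i _ => (h i).1)
    exact fun v w => (key v).trans (key w).symm

lemma sum_sub_iInf_le_iff {n : ℕ} [NeZero n] (u : Fin n → ℕ) (k : ℕ) :
    (∑ i, u i) - (⨅ i, u i) ≤ k ↔ ∀ i, (∑ j, u j) - u i ≤ k := by
  constructor
  · intro h i
    have : (⨅ i, u i) ≤ u i := ciInf_le (OrderBot.bddBelow (Set.range u)) i
    omega
  · intro h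
    obtain ⟨i, hi⟩ := Nat.sInf_mem (Set.range_nonempty u)
    rw [iInf, ← hi]
    exact h i

lemma le_sum_sub_of_ne {n : ℕ} (u : Fin n → ℕ) {i j : Fin n} (h : i ≠ j) :
    u i ≤ (∑ l, u l) - u j := by
  have := Finset.add_le_sum (f := u) (fun _ _ => Nat.zero_le _) (Finset.mem_univ i)
    (Finset.mem_univ j) h
  omega

/-- The number of magic `k`-labelings of `Gₙ` equals the number of tuples
`(u₁, …, uₙ) ∈ ℕⁿ` with `(u₁ + ⋯ + uₙ) - min {u₁, …, uₙ} ≤ k`. -/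
theorem magicCount_Gn_eq_tuples (n : ℕ) (hn : 2 ≤ n) (k : ℕ) :
    magicCount (Gedges n) k =
      Set.ncard {u : Fin n → ℕ | (∑ i, u i) - (⨅ i, u i) ≤ k} := by
  have : NeZero n := ⟨by omega⟩
  have : Nontrivial (Fin n) := Fin.nontrivial_iff_two_le.2 hn
  refine Set.ncard_congr (fun L _ i => L (edgeEquiv n (.inr (.inl i)))) ?_ ?_ ?_
  · rintro L ⟨hL, hk⟩
    rw [isMagic_Gedges_iff] at hL
    refine (sum_sub_iInf_le_iff _ k).2 fun i => ?_
    have := (hL i).2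
    have := hk (edgeEquiv n (.inl i))
    omega
  · rintro L M ⟨hL, -⟩ ⟨hM, -⟩ h
    rw [isMagic_Gedges_iff] at hL hM
    have h' (i : Fin n) :
        L (edgeEquiv n (.inr (.inl i))) = M (edgeEquiv n (.inr (.inl i))) := congrFun h i
    simp only [h'] at hL
    funext e
    obtain ⟨t, rfl⟩ := (edgeEquiv n).surjective e
    rcases t with i | i | i
    · have := (hL i).2
      have := (hM i).2
      omega
    · exact h' i
    · exact (hL i).1.trans (hM i).1.symm
  · intro u hu
    have hu' := (sum_sub_iInf_le_iff u k).1 hu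
    have hle (i : Fin n) : u i ≤ k := by
      obtain ⟨j, hj⟩ := exists_ne i
      exact (le_sum_sub_of_ne u hj.symm).trans (hu' j)
    refine ⟨fun e => Sum.elim (fun i => (∑ j, u j) - u i) (Sum.elim u u)
      ((edgeEquiv n).symm e), ⟨?_, fun e => ?_⟩, ?_⟩
    · rw [isMagic_Gedges_iff]
      intro i
      simpa using Nat.sub_add_cancel
        (Finset.single_le_sum (fun _ _ => Nat.zero_le _) (Finset.mem_univ i))
    · obtain ⟨t, rfl⟩ := (edgeEquiv n).surjective e
      rcases t with i | i | i <;> simp only [Equiv.symm_apply_apply, Sum.elim_inl, Sum.elim_inr]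
      · exact hu' i
      · exact hle i
      · exact hle i
    · funext i
      simp
end

section
/- For every integer n ≥ 1 and every t ∈ ℕ, the n-th difference of F_n satisfies Δ^n F_n(t) = ⌊t/n⌋ + 1. -/
open Finset

/-- `Fqp n k = ∑ C(j, n)` over `0 ≤ j ≤ k` with `j ≡ k (mod n)`. -/
def Fqp (n k : ℕ) : ℕ :=
  ∑ j ∈ (Finset.range (k + 1)).filter (fun j => j % n = k % n), j.choose n

/-- The first difference operator on functions `ℕ → ℚ`. -/
def fdiff (F : ℕ → ℚ) : ℕ → ℚ := fun t => F (t + 1) - F t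

theorem fdiff_eq_fwdDiff : fdiff = fwdDiff 1 := rfl

theorem Fqp_add_self {n : ℕ} (hn : 1 ≤ n) (k : ℕ) :
    Fqp n (k + n) = Fqp n k + (k + n).choose n := by
  have h : (Finset.range (k + n + 1)).filter (fun j => j % n = (k + n) % n) =
      insert (k + n) ((Finset.range (k + 1)).filter (fun j => j % n = k % n)) := by
    ext j
    simp only [mem_filter, mem_range, mem_insert, Nat.add_mod_right]
    constructor
    · rintro ⟨hj, hmod⟩
      rcases Nat.lt_or_ge j (k + 1) with hjk | hjk
      · exact Or.inr ⟨hjk, hmod⟩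
      · have hdvd : n ∣ j - k := (Nat.modEq_iff_dvd' (by lia)).1 hmod.symm
        have := Nat.le_of_dvd (by lia) hdvd
        exact Or.inl (by lia)
    · rintro (rfl | ⟨hj, hmod⟩)
      · exact ⟨by lia, Nat.add_mod_right k n⟩
      · exact ⟨by lia, hmod⟩
  rw [Fqp, h, sum_insert (by simp; lia), add_comm, Fqp]

theorem Fqp_eq_zero_of_lt {n k : ℕ} (hk : k < n) : Fqp n k = 0 :=
  sum_eq_zero fun j hj => Nat.choose_eq_zero_of_lt <| by
    have := mem_range.1 (mem_filter.1 hj).1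
    lia

theorem Fqp_eq_choose_of_lt {n k : ℕ} (hk : k < 2 * n) : Fqp n k = k.choose n := by
  rcases Nat.lt_or_ge k n with h | h
  · rw [Fqp_eq_zero_of_lt h, Nat.choose_eq_zero_of_lt h]
  · obtain ⟨m, rfl⟩ := Nat.exists_eq_add_of_le' h
    rw [Fqp_add_self (by lia), Fqp_eq_zero_of_lt (by lia), zero_add]

theorem fdiff_iter_choose_self (n : ℕ) :
    fdiff^[n] (fun k => (k.choose n : ℚ)) = fun _ => 1 := by
  induction n with
  | zero => simp
  | succ n ih =>
    have h : fdiff (fun k => (k.choose (n + 1) : ℚ)) = fun k => (k.choose n : ℚ) := by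
      ext k
      simp [fdiff, Nat.choose_succ_succ']
    rw [Function.iterate_succ_apply, h, ih]

theorem fdiff_iter_congr {f g : ℕ → ℚ} {n t : ℕ} (h : ∀ k ≤ t + n, f k = g k) :
    fdiff^[n] f t = fdiff^[n] g t := by
  simp only [fdiff_eq_fwdDiff, fwdDiff_iter_eq_sum_shift]
  refine sum_congr rfl fun k hk => ?_
  rw [h _ (by have := mem_range.1 hk; simp; lia)]

theorem fdiff_iter_Fqp_add_self {n : ℕ} (hn : 1 ≤ n) (t : ℕ) :
    fdiff^[n] (fun k => (Fqp n k : ℚ)) (t + n) =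
      fdiff^[n] (fun k => (Fqp n k : ℚ)) t + 1 := by
  have h : (fun k => (Fqp n (k + n) : ℚ)) =
      (fun k => (Fqp n k : ℚ)) + fun k => ((k + n).choose n : ℚ) := by
    ext k
    simp [Fqp_add_self hn]
  have hchoose : fdiff^[n] (fun k => ((k + n).choose n : ℚ)) t = 1 :=
    (fwdDiff_iter_comp_add 1 (fun k : ℕ => (k.choose n : ℚ)) n n t).trans
      (congrFun (fdiff_iter_choose_self n) (t + n))
  rw [fdiff_eq_fwdDiff] at hchoose ⊢
  rw [← fwdDiff_iter_comp_add 1 (fun k => (Fqp n k : ℚ)), h, fwdDiff_iter_add, Pi.add_apply,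
    hchoose]

/-- The `n`-th difference of `Fₙ` satisfies `Δⁿ Fₙ (t) = ⌊t/n⌋ + 1`. -/
theorem nth_difference_Fn (n : ℕ) (hn : 1 ≤ n) (t : ℕ) :
    (fdiff^[n] (fun k => (Fqp n k : ℚ))) t = (t / n : ℕ) + 1 := by
  induction t using Nat.strong_induction_on with
  | _ t ih =>
    rcases Nat.lt_or_ge t n with h | h
    · rw [fdiff_iter_congr (g := fun k => (k.choose n : ℚ))
        fun k hk => by rw [Fqp_eq_choose_of_lt (by lia)], fdiff_iter_choose_self,
        Nat.div_eq_of_lt h]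
      simp
    · obtain ⟨m, rfl⟩ := Nat.exists_eq_add_of_le' h
      rw [fdiff_iter_Fqp_add_self hn, ih m (by lia), Nat.add_div_right m hn]
      push_cast
      ring
end
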